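/- Let n ≥ 2 and let f, h : S¹ → S¹ be orientation-preserving homeomorphisms of the circle satisfying h ∘ f ∘ h⁻¹ = fⁿ. If h is minimal (every h-orbit is dense in S¹, e.g. if h is topologically conjugate to an irrational rotation) and f has a periodic point, then the set of periodic points of f is dense in S¹ and consequently there exists m ≥ 1 with f^m = Id; in particular the action of BS(1,n) generated by f and h is not faithful. -/

import Mathlib

noncomputable section

/-- The circle `S¹ = ℝ/ℤ`. -/
abbrev S1 := AddCircle (1 : ℝ)

/-- `F` (a monotone degree-one lift, invertible, hence the lift of an orientation
preserving circle homeomorphism) is a lift of the circle map `g`. -/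
def IsLiftOf (F : CircleDeg1Liftˣ) (g : S1 ≃ₜ S1) : Prop :=
  ∀ x : ℝ, g (x : S1) = (((F : CircleDeg1Lift) x : ℝ) : S1)

/-- The relator of the Baumslag–Solitar group `BS(1,n) = ⟨a,b | a b a⁻¹ = bⁿ⟩`,
with `a` the generator `0` and `b` the generator `1` of the free group on two letters. -/
def bsRel (n : ℕ) : Set (FreeGroup (Fin 2)) :=
  {FreeGroup.of 0 * FreeGroup.of 1 * (FreeGroup.of 0)⁻¹ * ((FreeGroup.of 1) ^ n)⁻¹}

/-- The action of `BS(1,n)` generated by `h ≡ a` and `f ≡ b` is faithful: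
every word in the free group on two letters that acts as the identity lies in the
normal closure of the Baumslag–Solitar relator, i.e. the induced homomorphism
`BS(1,n) → Homeo₊(S¹)` is injective. -/
def IsFaithfulBS (n : ℕ) (f h : S1 ≃ₜ S1) : Prop :=
  ∀ w : FreeGroup (Fin 2),
    FreeGroup.lift ![h.toEquiv, f.toEquiv] w = 1 → w ∈ Subgroup.normalClosure (bsRel n)

/-- A circle homeomorphism is minimal if every full orbit `{h^k x : k ∈ ℤ}` is dense. -/
def IsMinimalHomeo (h : S1 ≃ₜ S1) : Prop :=
  ∀ x : S1, Dense (Set.range fun k : ℤ => (h.toEquiv ^ k) x)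

/-- Iterates of a circle homeomorphism are lifted by powers of a lift. -/
theorem IsLiftOf.iterate {F : CircleDeg1Liftˣ} {g : S1 ≃ₜ S1} (hF : IsLiftOf F g) (k : ℕ)
    (x : ℝ) : (⇑g)^[k] (x : S1) = ((((F ^ k : CircleDeg1Liftˣ) : CircleDeg1Lift) x : ℝ) : S1) := by
  induction k with
  | zero => simp
  | succ k ih =>
    rw [Function.iterate_succ_apply', ih, hF, pow_succ', Units.val_mul, CircleDeg1Lift.mul_apply]

/-- An invertible monotone degree-one lift is strictly monotone. -/
theorem strictMono_circleDeg1Lift_units (F : CircleDeg1Liftˣ) :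
    StrictMono (F : CircleDeg1Lift) := by
  refine (F : CircleDeg1Lift).monotone.strictMono_of_injective fun x y hxy => ?_
  have h := congrArg (↑F⁻¹ : CircleDeg1Lift) hxy
  simpa using h

/-- Two reals with the same image in `ℝ/ℤ` differ by an integer. -/
theorem exists_int_of_coe_S1_eq {x y : ℝ} (h : (x : S1) = (y : S1)) : ∃ j : ℤ, x = y + j := by
  obtain ⟨j, hj⟩ := (QuotientAddGroup.eq_iff_sub_mem.mp h)
  refine ⟨j, ?_⟩
  simp only [zsmul_eq_mul, mul_one] at hj
  linarith

/-- If an iterate `g^k` of an orientation preserving circle homeomorphism has a fixed point,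
then its powers have no fixed points other than those of `g^k`. -/
theorem IsLiftOf.iterate_mul_fixed_iff {F : CircleDeg1Liftˣ} {g : S1 ≃ₜ S1} (hF : IsLiftOf F g)
    {k n : ℕ} (hn : 0 < n) {q : S1} (hq : (⇑g)^[k] q = q) (x : S1) :
    (⇑g)^[k * n] x = x ↔ (⇑g)^[k] x = x := by
  refine ⟨fun hx => ?_, fun hx => by
    rw [Function.iterate_mul]; exact Function.iterate_fixed hx n⟩
  induction q using QuotientAddGroup.induction_on with | H q => ?_
  induction x using QuotientAddGroup.induction_on with | H x => ?_
  erw [hF.iterate] at hq hx ⊢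
  obtain ⟨j, hj⟩ := exists_int_of_coe_S1_eq hq
  obtain ⟨l, hl⟩ := exists_int_of_coe_S1_eq hx
  rw [pow_mul] at hl
  set G : CircleDeg1Lift := ((F ^ k : CircleDeg1Liftˣ) : CircleDeg1Lift) with hG
  have hτ : G.translationNumber = j := G.translationNumber_of_eq_add_int hj
  rw [Units.val_pow_eq_pow_val, ← hG] at hl
  have hτ' : G.translationNumber = l / n := G.translationNumber_of_map_pow_eq_add_int hl hn
  have hlj : (l : ℝ) = n * j := by
    have : (n : ℝ) ≠ 0 := by positivity
    rw [← hτ, hτ']; field_simp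
  have hGx : G x = x + j := by
    rw [← G.iterate_pos_eq_iff hn, ← CircleDeg1Lift.coe_pow, hl, hlj]
  rw [hGx]
  simp

/-- The generator `b` of `BS(1,n)` has infinite order, as seen in the affine action on `ℚ`. -/
theorem of_one_pow_notMem_normalClosure_bsRel {n m : ℕ} (hn : n ≠ 0) (hm : m ≠ 0) :
    (FreeGroup.of 1 : FreeGroup (Fin 2)) ^ m ∉ Subgroup.normalClosure (bsRel n) := by
  have hn' : (n : ℚ) ≠ 0 := by exact_mod_cast hn
  let φ : FreeGroup (Fin 2) →* Equiv.Perm ℚ :=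
    FreeGroup.lift ![Equiv.mulLeft₀ (n : ℚ) hn', Equiv.addRight (1 : ℚ)]
  have hpow (j : ℕ) (x : ℚ) : (Equiv.addRight (1 : ℚ) ^ j : Equiv.Perm ℚ) x = x + j := by
    simp
  have hle : Subgroup.normalClosure (bsRel n) ≤ φ.ker := by
    refine Subgroup.normalClosure_le_normal ?_
    rintro _ rfl
    rw [SetLike.mem_coe, MonoidHom.mem_ker, map_mul, map_inv, mul_inv_eq_one, map_mul, map_mul,
      map_inv, mul_inv_eq_iff_eq_mul, map_pow]
    ext x
    simp only [φ, FreeGroup.lift_apply_of, Equiv.Perm.mul_apply, Matrix.cons_val_zero,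
      Matrix.cons_val_one, hpow]
    simp [mul_add]
  intro hmem
  have h := DFunLike.congr_fun (MonoidHom.mem_ker.mp (hle hmem)) 0
  rw [map_pow] at h
  simp only [φ, FreeGroup.lift_apply_of, Matrix.cons_val_one] at h
  simp [hm] at h

/-- A set invariant under a permutation and its inverse is invariant under all its powers. -/
theorem Equiv.Perm.zpow_mem_of_mem_iff {α : Type*} {e : Equiv.Perm α} {s : Set α}
    (hs : ∀ x, e x ∈ s ↔ x ∈ s) {x : α} (hx : x ∈ s) (i : ℤ) : (e ^ i) x ∈ s := by
  induction i with
  | zero => simpa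
  | succ i ih => rwa [add_comm, zpow_add, zpow_one, Equiv.Perm.mul_apply, hs]
  | pred i ih =>
    rwa [← hs, ← Equiv.Perm.mul_apply, ← zpow_one_add, add_sub_cancel]

/-- Let `n ≥ 2` and let `f, h` be orientation-preserving circle
homeomorphisms with `h ∘ f ∘ h⁻¹ = fⁿ` (equivalently `h ∘ f = fⁿ ∘ h`).  If `h` is
minimal and `f` has a periodic point, then the periodic points of `f` are dense in `S¹`,
there is `m ≥ 1` with `f^m = Id`, and consequently the `BS(1,n)`-action generated by
`f` and `h` is not faithful. -/
theorem minimal_h_implies_not_faithful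
    (n : ℕ) (hn : 2 ≤ n) (f h : S1 ≃ₜ S1) (F H : CircleDeg1Liftˣ)
    (hF : IsLiftOf F f) (hH : IsLiftOf H h)
    (hrel : ∀ x : S1, h (f x) = (⇑f)^[n] (h x))
    (hmin : IsMinimalHomeo h)
    (hper : ∃ q : S1, ∃ k : ℕ, 1 ≤ k ∧ (⇑f)^[k] q = q) :
    Dense {q : S1 | ∃ k : ℕ, 1 ≤ k ∧ (⇑f)^[k] q = q} ∧
    (∃ m : ℕ, 1 ≤ m ∧ (⇑f)^[m] = id) ∧
    ¬ IsFaithfulBS n f h := by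
  obtain ⟨q, k, hk, hq⟩ := hper
  have hsemi (k : ℕ) (x : S1) : h ((⇑f)^[k] x) = (⇑f)^[k * n] (h x) := by
    rw [mul_comm, Function.iterate_mul]
    exact (Function.Semiconj.iterate_right (f := h) (ga := f) (gb := (⇑f)^[n]) hrel k) x
  have hinv (x : S1) : h x ∈ {y | (⇑f)^[k] y = y} ↔ x ∈ {y | (⇑f)^[k] y = y} := by
    rw [Set.mem_ofPred_eq, Set.mem_ofPred_eq, ← hF.iterate_mul_fixed_iff (by omega : 0 < n) hq,
      ← hsemi, h.injective.eq_iff]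
  have hdense : Dense {y | (⇑f)^[k] y = y} :=
    (hmin q).mono <| Set.range_subset_iff.mpr
      (Equiv.Perm.zpow_mem_of_mem_iff (e := h.toEquiv) hinv hq)
  have hid : (⇑f)^[k] = id :=
    Continuous.ext_on hdense (f.continuous.iterate k) continuous_id fun _ hy => hy
  refine ⟨hdense.mono fun y hy => ⟨k, hk, hy⟩, ⟨k, hk, hid⟩, fun hfaith => ?_⟩
  refine of_one_pow_notMem_normalClosure_bsRel (n := n) (m := k) (by omega) (by omega)
    (hfaith _ ?_)
  ext x
  rw [map_pow, FreeGroup.lift_apply_of, Matrix.cons_val_one, Matrix.cons_val_zero,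
    Equiv.Perm.coe_pow]
  exact congrFun hid x
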